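/- Let E be a Riesz space and let p, q : ℕ → ℕ satisfy the deferred property. Suppose (z_n) is a sequence in E with z_n ↓ 0, i.e., (z_n) is decreasing and inf_{n∈ℕ} z_n = 0. Then for every set K ⊆ ℕ with δ_{p,q}(K) = 1 and every (x_n) ∈ C^{p,q}_{(z_n)}, there exist x ∈ E and a set J ⊆ K with δ_{p,q}(J) = 1 such that |x_j − x| ≤ z_j for all j ∈ J; that is, C^{p,q}_{(z_n)} ⊆ C^{p,q}_{(z_{k})_{k∈K}} for each subsequence of (z_n) indexed by a set K of deferred density one. -/

import Mathlib

open Filter Topology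

variable {E : Type*} [AddCommGroup E] [Lattice E]
  [CovariantClass E E (· + ·) (· ≤ ·)] [Module ℝ E] [PosSMulMono ℝ E]

/-- `p` and `q` satisfy the deferred property: `p n < q n` for all `n` and `q n → ∞`. -/
def DeferredProperty (p q : ℕ → ℕ) : Prop :=
  (∀ n, p n < q n) ∧ Tendsto q atTop atTop

open Classical in
/-- The ratio `|{k ∈ K : p n < k ≤ q n}| / (q n - p n)`. -/
noncomputable def deferredRatio (p q : ℕ → ℕ) (K : Set ℕ) (n : ℕ) : ℝ :=
  (((Finset.Ioc (p n) (q n)).filter (fun k => k ∈ K)).card : ℝ) / ((q n : ℝ) - (p n : ℝ))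

/-- The deferred density of `K ⊆ ℕ` is `a`. -/
def DeferredDensity (p q : ℕ → ℕ) (K : Set ℕ) (a : ℝ) : Prop :=
  Tendsto (deferredRatio p q K) atTop (nhds a)

/-- `z` is deferred statistical order decreasing to `0`: there is an (infinite) set
`K = {k₁ < k₂ < ⋯}` of deferred density one along which `z` is decreasing with infimum `0`. -/
def DStatDecreasing (p q : ℕ → ℕ) (z : ℕ → E) : Prop :=
  ∃ K : Set ℕ, K.Infinite ∧ DeferredDensity p q K 1 ∧
    (∀ i ∈ K, ∀ j ∈ K, i ≤ j → z j ≤ z i) ∧ IsGLB (z '' K) 0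

/-- `x` is deferred statistical order convergent to `l`. -/
def DStatOrderConv (p q : ℕ → ℕ) (x : ℕ → E) (l : E) : Prop :=
  ∃ z : ℕ → E, DStatDecreasing p q z ∧
    ∃ K : Set ℕ, K.Infinite ∧ DeferredDensity p q K 1 ∧ ∀ k ∈ K, |x k - l| ≤ z k

/-- The class `C^{p,q}_{(z_n)}` of all sequences deferred statistically order convergent
with dominating sequence `z`. -/
def CClass (p q : ℕ → ℕ) (z : ℕ → E) : Set (ℕ → E) :=
  {x | ∃ l : E, ∃ K : Set ℕ, DeferredDensity p q K 1 ∧ ∀ k ∈ K, |x k - l| ≤ z k}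

open Classical in
theorem deferredRatio_mono {p q : ℕ → ℕ} (hpq : ∀ n, p n < q n) {A B : Set ℕ} (h : A ⊆ B)
    (n : ℕ) : deferredRatio p q A n ≤ deferredRatio p q B n := by
  have hpos : (0 : ℝ) ≤ (q n : ℝ) - p n := sub_nonneg.2 (by exact_mod_cast (hpq n).le)
  unfold deferredRatio
  refine div_le_div_of_nonneg_right ?_ hpos
  exact_mod_cast Finset.card_le_card (Finset.monotone_filter_right _ fun _ _ hk => h hk)

open Classical in
theorem deferredRatio_add_sub_one_le_inter {p q : ℕ → ℕ} (hpq : ∀ n, p n < q n) (A B : Set ℕ)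
    (n : ℕ) : deferredRatio p q A n + deferredRatio p q B n - 1 ≤
      deferredRatio p q (A ∩ B) n := by
  have hpos : (0 : ℝ) < (q n : ℝ) - p n := sub_pos.2 (by exact_mod_cast hpq n)
  unfold deferredRatio
  rw [← add_div, div_sub_one hpos.ne']
  refine div_le_div_of_nonneg_right ?_ hpos.le
  set s := Finset.Ioc (p n) (q n) with hs
  have hcard : (s.card : ℝ) = q n - p n := by
    rw [hs, Nat.card_Ioc, Nat.cast_sub (hpq n).le]
  have hunion : (s.filter (· ∈ A) ∪ s.filter (· ∈ B)).card ≤ s.card :=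
    Finset.card_le_card
      (Finset.union_subset (Finset.filter_subset _ _) (Finset.filter_subset _ _))
  have hadd := Finset.card_union_add_card_inter (s.filter (· ∈ A)) (s.filter (· ∈ B))
  rw [← Finset.filter_and] at hadd
  have key : (s.filter (· ∈ A)).card + (s.filter (· ∈ B)).card ≤
      s.card + (s.filter (· ∈ A ∩ B)).card := by
    simp only [Set.mem_inter_iff]
    omega
  rw [← hcard, sub_le_iff_le_add, add_comm _ (s.card : ℝ)]
  norm_cast
  convert key

theorem DeferredDensity.inter {p q : ℕ → ℕ} (hpq : ∀ n, p n < q n) {A B : Set ℕ}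
    (hA : DeferredDensity p q A 1) (hB : DeferredDensity p q B 1) :
    DeferredDensity p q (A ∩ B) 1 := by
  have hlow : Tendsto (fun n => deferredRatio p q A n + deferredRatio p q B n - 1)
      atTop (𝓝 1) := by
    simpa using (Tendsto.add hA hB).sub_const 1
  exact tendsto_of_tendsto_of_tendsto_of_le_of_le hlow hA
    (deferredRatio_add_sub_one_le_inter hpq A B)
    (deferredRatio_mono hpq Set.inter_subset_left)

theorem stmt19 (p q : ℕ → ℕ) (hpq : DeferredProperty p q) (z : ℕ → E)
    (hdec : ∀ m n, m ≤ n → z n ≤ z m) (hinf : IsGLB (Set.range z) 0)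
    (K : Set ℕ) (hK : DeferredDensity p q K 1)
    (x : ℕ → E) (hx : x ∈ CClass p q z) :
    ∃ l : E, ∃ J : Set ℕ, J ⊆ K ∧ DeferredDensity p q J 1 ∧
      ∀ j ∈ J, |x j - l| ≤ z j := by
  obtain ⟨l, A, hA, hxA⟩ := hx
  exact ⟨l, K ∩ A, Set.inter_subset_left, hK.inter hpq.1 hA, fun j hj => hxA j hj.2⟩
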